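/- For every t > 0, the map t ↦ ⟨q_{12}q̃_{12}q_{23}q̃_{23}⟩_t is differentiable and d/dt ⟨q_{12}q̃_{12}q_{23}q̃_{23}⟩_t = ⟨ q_{12}q̃_{12}q_{23}q̃_{23}q_{13}q̃_{13} + 2 q_{12}²q̃_{12}²q_{23}q̃_{23} − 6 q_{12}q̃_{12}q_{23}q̃_{23}q_{34}q̃_{34} − 3 q_{12}q̃_{12}q_{13}q̃_{13}q_{14}q̃_{14} + 6 q_{12}q̃_{12}q_{34}q̃_{34}q_{45}q̃_{45} ⟩_t. -/

import Mathlib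

open MeasureTheory ProbabilityTheory Filter

noncomputable section

/-- spin value of a Boolean configuration coordinate: `±1`. -/
def spinval (b : Bool) : ℝ := if b then 1 else -1

/-- Joint law of the two independent i.i.d. standard Gaussian families `(Ĵ, J̃)`. -/
def couplingLaw (N M : ℕ) :
    Measure (((Fin M × Fin M) → ℝ) × ((Fin N × Fin M) → ℝ)) :=
  (Measure.pi fun _ : Fin M × Fin M => gaussianReal 0 1).prod
    (Measure.pi fun _ : Fin N × Fin M => gaussianReal 0 1)

/-- Random Gibbs weight on a pair `(σ, τ)`:
`ξ_τ · exp(√(t/(NM)) Σ_{i,k} J̃_{ik} τ_k σ_i)` with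
`ξ_τ = exp((β/√M) Σ_{k,l} Ĵ_{kl} τ_k τ_l)`. -/
def cavityWeight (N M : ℕ) (β t : ℝ)
    (J : ((Fin M × Fin M) → ℝ) × ((Fin N × Fin M) → ℝ))
    (στ : (Fin N → Bool) × (Fin M → Bool)) : ℝ :=
  Real.exp ((β / Real.sqrt M) * ∑ k : Fin M, ∑ l : Fin M,
      J.1 (k, l) * spinval (στ.2 k) * spinval (στ.2 l)
    + Real.sqrt (t / ((N : ℝ) * (M : ℝ))) * ∑ i : Fin N, ∑ k : Fin M,
      J.2 (i, k) * spinval (στ.2 k) * spinval (στ.1 i))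

/-- Partition function of the cavity Gibbs measure. -/
def cavityZ (N M : ℕ) (β t : ℝ)
    (J : ((Fin M × Fin M) → ℝ) × ((Fin N × Fin M) → ℝ)) : ℝ :=
  ∑ στ : (Fin N → Bool) × (Fin M → Bool), cavityWeight N M β t J στ

/-- Quenched replicated Gibbs average `⟨f⟩_t = E[Ω_t(f)]` over `n` replicas. -/
def replicaAvg (n N M : ℕ) (β t : ℝ)
    (f : (Fin n → (Fin N → Bool) × (Fin M → Bool)) → ℝ) : ℝ :=
  ∫ J, (∑ R : Fin n → (Fin N → Bool) × (Fin M → Bool),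
      (∏ a : Fin n, cavityWeight N M β t J (R a)) * f R) / (cavityZ N M β t J) ^ n
    ∂(couplingLaw N M)

/-- Overlap `(1/N) Σ_i σ_i σ'_i` of two spin configurations. -/
def ovlp (N : ℕ) (σ σ' : Fin N → Bool) : ℝ :=
  (1 / (N : ℝ)) * ∑ i : Fin N, spinval (σ i) * spinval (σ' i)

/-- Product overlap `q_{ab} q̃_{ab}` of two replicas. -/
def qq (N M n : ℕ) (R : Fin n → (Fin N → Bool) × (Fin M → Bool)) (a b : Fin n) : ℝ :=
  ovlp N (R a).1 (R b).1 * ovlp M (R a).2 (R b).2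

/-- Replicated Gibbs average of `f` over `n` replicas for the log-weights `H`. -/
def gibbsAvg {S : Type*} [Fintype S] (n : ℕ) (H : S → ℝ) (f : (Fin n → S) → ℝ) : ℝ :=
  (∑ R : Fin n → S, (∏ a, Real.exp (H (R a))) * f R) / (∑ s, Real.exp (H s)) ^ n

/-- Replica form of the derivative of a Gibbs average when the log-weights move in direction `v`;
the new replica is the one with index `0`. -/
def replicaDeriv {S : Type*} {n : ℕ} (v : S → ℝ) (f : (Fin n → S) → ℝ)
    (R : Fin (n + 1) → S) : ℝ :=
  f (Fin.tail R) * (∑ a : Fin n, v (R a.succ) - n * v (R 0))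

section GibbsAvg

variable {S : Type*} {n : ℕ}

lemma replicaDeriv_sum {ι : Type*} [Fintype ι] (c : ι → ℝ) (v : ι → S → ℝ)
    (f : (Fin n → S) → ℝ) :
    replicaDeriv (fun s => ∑ e, c e * v e s) f
      = fun R => ∑ e, c e * replicaDeriv (v e) f R := by
  funext R
  simp only [replicaDeriv]
  rw [Finset.sum_comm, Finset.mul_sum, ← Finset.sum_sub_distrib, Finset.mul_sum]
  refine Finset.sum_congr rfl fun e _ => ?_
  rw [← Finset.mul_sum]
  ring

lemma replicaDeriv_const_mul (c : ℝ) (v : S → ℝ) (f : (Fin n → S) → ℝ) :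
    replicaDeriv (fun s => c * v s) f = fun R => c * replicaDeriv v f R := by
  simpa using replicaDeriv_sum (ι := Unit) (fun _ => c) (fun _ => v) f

variable [Fintype S]

lemma gibbsAvg_sum {ι : Type*} (T : Finset ι) (H : S → ℝ) (c : ι → ℝ)
    (f : ι → (Fin n → S) → ℝ) :
    gibbsAvg n H (fun R => ∑ e ∈ T, c e * f e R) = ∑ e ∈ T, c e * gibbsAvg n H (f e) := by
  simp only [gibbsAvg, Finset.mul_sum]
  rw [Finset.sum_comm, Finset.sum_div]
  refine Finset.sum_congr rfl fun e _ => ?_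
  rw [← mul_div_assoc, Finset.mul_sum]
  congr 1
  refine Finset.sum_congr rfl fun R _ => by ring

lemma gibbsAvg_const_mul (H : S → ℝ) (c : ℝ) (f : (Fin n → S) → ℝ) :
    gibbsAvg n H (fun R => c * f R) = c * gibbsAvg n H f := by
  simpa using gibbsAvg_sum Finset.univ H (fun _ : Unit => c) (fun _ => f)

lemma gibbsAvg_add (H : S → ℝ) (f g : (Fin n → S) → ℝ) :
    gibbsAvg n H (fun R => f R + g R) = gibbsAvg n H f + gibbsAvg n H g := by
  simp only [gibbsAvg, mul_add, Finset.sum_add_distrib, add_div]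

lemma gibbsAvg_perm (H : S → ℝ) (e : Equiv.Perm (Fin n)) (f : (Fin n → S) → ℝ) :
    gibbsAvg n H (fun R => f (R ∘ e)) = gibbsAvg n H f := by
  unfold gibbsAvg
  congr 1
  refine Fintype.sum_equiv (e.symm.arrowCongr (Equiv.refl S)) _ _ fun R => ?_
  have h : (e.symm.arrowCongr (Equiv.refl S)) R = R ∘ e := by
    ext a; simp [Equiv.arrowCongr]
  rw [h, ← Equiv.prod_comp e]
  rfl

lemma abs_gibbsAvg_le [Nonempty S] (H : S → ℝ) (f : (Fin n → S) → ℝ) :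
    |gibbsAvg n H f| ≤ ∑ R, |f R| := by
  have hZ : (∑ s, Real.exp (H s)) ^ n = ∑ R : Fin n → S, ∏ a, Real.exp (H (R a)) := by
    rw [Finset.sum_pow', Fintype.piFinset_univ]
  have hpos : 0 < (∑ s, Real.exp (H s)) ^ n := by positivity
  rw [gibbsAvg, abs_div, abs_of_pos hpos, div_le_iff₀ hpos, hZ]
  refine (Finset.abs_sum_le_sum_abs _ _).trans ?_
  rw [Finset.mul_sum]
  refine Finset.sum_le_sum fun R _ => ?_
  rw [abs_mul, abs_of_pos (by positivity), mul_comm]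
  gcongr
  exact Finset.single_le_sum (f := fun R => |f R|) (fun _ _ => abs_nonneg _) (Finset.mem_univ R)

lemma Continuous.gibbsAvg [Nonempty S] {X : Type*} [TopologicalSpace X] {H : X → S → ℝ}
    (hH : ∀ s, Continuous fun x => H x s) (f : (Fin n → S) → ℝ) :
    Continuous fun x => gibbsAvg n (H x) f := by
  unfold _root_.gibbsAvg
  have h : ∀ x, (∑ s, Real.exp (H x s)) ^ n ≠ 0 := fun x => by positivity
  refine Continuous.div ?_ ?_ h <;> fun_prop

lemma HasDerivAt.gibbsAvg [Nonempty S] {H : ℝ → S → ℝ} {v : S → ℝ} {x : ℝ}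
    (hH : ∀ s, HasDerivAt (fun y => H y s) (v s) x) (f : (Fin n → S) → ℝ) :
    HasDerivAt (fun y => gibbsAvg n (H y) f) (gibbsAvg (n + 1) (H x) (replicaDeriv v f)) x := by
  have hprod : ∀ R : Fin n → S, HasDerivAt (fun y => (∏ a, Real.exp (H y (R a))) * f R)
      ((∏ a, Real.exp (H x (R a))) * (∑ a, v (R a)) * f R) x := by
    intro R
    simp_rw [← Real.exp_sum]
    exact ((HasDerivAt.fun_sum fun a _ => hH (R a)).exp).mul_const _
  have hnum := HasDerivAt.fun_sum (u := Finset.univ) fun R _ => hprod R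
  have hZ := (HasDerivAt.fun_sum (u := Finset.univ) fun s _ => (hH s).exp).fun_pow n
  have hpos : 0 < ∑ s, Real.exp (H x s) := by positivity
  refine (hnum.fun_div hZ (by positivity)).congr_deriv ?_
  set Z := ∑ s, Real.exp (H x s) with hZdef
  have key : ∑ R : Fin (n + 1) → S, (∏ a, Real.exp (H x (R a))) * replicaDeriv v f R
      = (∑ R : Fin n → S, (∏ a, Real.exp (H x (R a))) * (∑ a, v (R a)) * f R) * Z
        - n * ((∑ R : Fin n → S, (∏ a, Real.exp (H x (R a))) * f R)
          * ∑ s, Real.exp (H x s) * v s) := by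
    have hsplit : ∀ A B : ℝ, A * Z - n * (B * ∑ s, Real.exp (H x s) * v s)
        = ∑ s, (A * Real.exp (H x s) - n * (B * (Real.exp (H x s) * v s))) := by
      intro A B
      simp only [Finset.sum_sub_distrib, ← Finset.mul_sum, hZdef]
    rw [← (Fin.consEquiv fun _ => S).sum_comp, Fintype.sum_prod_type, Finset.sum_comm,
      Finset.sum_mul, Finset.sum_mul, Finset.mul_sum, ← Finset.sum_sub_distrib]
    refine Finset.sum_congr rfl fun R _ => ?_
    rw [hsplit]
    refine Finset.sum_congr rfl fun s _ => ?_
    simp only [Fin.consEquiv, Equiv.coe_fn_mk, replicaDeriv, Fin.prod_univ_succ, Fin.cons_zero,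
      Fin.cons_succ, Fin.tail_cons]
    ring
  rw [_root_.gibbsAvg, key]
  rcases n with _ | n
  · simp
  · field_simp
    simp only [Nat.add_sub_cancel]
    ring

end GibbsAvg

section GaussianIntegrationByParts

/-- Gaussian integration by parts on the line. -/
lemma integral_id_mul_gaussianReal {g g' : ℝ → ℝ} (hg : ∀ x, HasDerivAt g (g' x) x)
    (hg'm : Measurable g') {C C' : ℝ} (hC : ∀ x, |g x| ≤ C) (hC' : ∀ x, |g' x| ≤ C') :
    ∫ x, x * g x ∂gaussianReal 0 1 = ∫ x, g' x ∂gaussianReal 0 1 := by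
  have hgm : Measurable g :=
    (continuous_iff_continuousAt.2 fun x => (hg x).continuousAt).measurable
  have hpdf : ∀ x, HasDerivAt (gaussianPDFReal 0 1) (-(x * gaussianPDFReal 0 1 x)) x := by
    intro x
    have h : HasDerivAt (fun y : ℝ => -(y - 0) ^ 2 / (2 * ((1 : NNReal) : ℝ))) (-x) x := by
      have := ((hasDerivAt_id x).pow 2).neg.div_const 2
      refine (this.congr_deriv (by simp; ring)).congr_of_eventuallyEq
        (.of_forall fun y => by simp)
    refine (h.exp.const_mul _).congr_deriv ?_
    simp only [gaussianPDFReal]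
    ring
  have hi := integrable_gaussianPDFReal 0 1
  have hxi : Integrable fun x : ℝ => x * gaussianPDFReal 0 1 x := by
    have h := (memLp_id_gaussianReal' (μ := 0) (v := 1) 1 (by simp)).integrable le_rfl
    rw [gaussianReal_of_var_ne_zero _ one_ne_zero,
      integrable_withDensity_iff_integrable_smul₀' (measurable_gaussianPDF 0 1).aemeasurable
        (.of_forall fun _ => gaussianPDF_lt_top)] at h
    refine h.congr (.of_forall fun x => ?_)
    simp [toReal_gaussianPDF, mul_comm]
  have huv' : Integrable (g * fun x => -(x * gaussianPDFReal 0 1 x)) :=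
    hxi.neg.bdd_mul hgm.aestronglyMeasurable (.of_forall hC)
  have hu'v : Integrable (g' * gaussianPDFReal 0 1) :=
    hi.bdd_mul hg'm.aestronglyMeasurable (.of_forall hC')
  have huv : Integrable (g * gaussianPDFReal 0 1) :=
    hi.bdd_mul hgm.aestronglyMeasurable (.of_forall hC)
  have h := integral_mul_deriv_eq_deriv_mul_of_integrable (fun x _ => hg x) (fun x _ => hpdf x)
    huv' hu'v huv
  rw [integral_gaussianReal_eq_integral_smul one_ne_zero,
    integral_gaussianReal_eq_integral_smul one_ne_zero]
  simp only [smul_eq_mul]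
  calc ∫ x, gaussianPDFReal 0 1 x * (x * g x)
      = -∫ x, g x * -(x * gaussianPDFReal 0 1 x) := by
        rw [← integral_neg]; congr 1; funext x; ring
    _ = ∫ x, gaussianPDFReal 0 1 x * g' x := by
        rw [h, neg_neg]; congr 1; funext x; ring

variable {E : Type*} [Fintype E]

lemma measurePreserving_update_pi [DecidableEq E] (μ : E → Measure ℝ)
    [∀ e, IsProbabilityMeasure (μ e)] (e : E) :
    MeasurePreserving (fun p : (E → ℝ) × ℝ => Function.update p.1 e p.2)
      ((Measure.pi μ).prod (μ e)) (Measure.pi μ) := by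
  have hm : Measurable fun p : (E → ℝ) × ℝ => Function.update p.1 e p.2 := by
    refine measurable_pi_lambda _ fun i => ?_
    by_cases h : i = e
    · subst h; simpa using measurable_snd
    · simp only [Function.update_of_ne h]
      exact (measurable_pi_apply i).comp measurable_fst
  refine ⟨hm, (Measure.pi_eq fun s hs => ?_).symm⟩
  rw [Measure.map_apply hm (MeasurableSet.univ_pi hs)]
  have hpre : (fun p : (E → ℝ) × ℝ => Function.update p.1 e p.2) ⁻¹' Set.univ.pi s
      = (Set.univ.pi (Function.update s e Set.univ)) ×ˢ s e := by
    ext p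
    simp only [Set.mem_preimage, Set.mem_pi, Set.mem_univ, true_implies, Set.mem_prod]
    constructor
    · refine fun h => ⟨fun i => ?_, by simpa using h e⟩
      by_cases hi : i = e
      · subst hi; simp
      · simpa [Function.update_of_ne hi] using h i
    · rintro ⟨h, he⟩ i
      by_cases hi : i = e
      · subst hi; simpa using he
      · simpa [Function.update_of_ne hi] using h i
  rw [hpre, Measure.prod_prod, Measure.pi_pi, ← Finset.prod_erase_mul _ _ (Finset.mem_univ e),
    ← Finset.prod_erase_mul _ (fun i => μ i (s i)) (Finset.mem_univ e)]
  simp only [Function.update_self, measure_univ, mul_one]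
  congr 1
  refine Finset.prod_congr rfl fun i hi => ?_
  rw [Function.update_of_ne (Finset.ne_of_mem_erase hi)]

lemma integrable_eval_pi_gaussianReal (e : E) :
    Integrable (fun x : E → ℝ => x e) (Measure.pi fun _ : E => gaussianReal 0 1) :=
  (measurePreserving_eval (fun _ : E => gaussianReal 0 1) e).integrable_comp_of_integrable
    ((memLp_id_gaussianReal' (μ := 0) (v := 1) 1 (by simp)).integrable le_rfl)

lemma integrable_eval_mul_pi_gaussianReal (e : E) {g : (E → ℝ) → ℝ} (hgm : Measurable g)
    {C : ℝ} (hC : ∀ x, |g x| ≤ C) :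
    Integrable (fun x => x e * g x) (Measure.pi fun _ : E => gaussianReal 0 1) :=
  (integrable_eval_pi_gaussianReal e).mul_bdd hgm.aestronglyMeasurable (.of_forall hC)

lemma integrable_snd_eval {A : Type*} [MeasurableSpace A]
    (ν : Measure A) [IsProbabilityMeasure ν] (e : E) :
    Integrable (fun J : A × (E → ℝ) => J.2 e)
      (ν.prod (Measure.pi fun _ : E => gaussianReal 0 1)) :=
  (integrable_eval_pi_gaussianReal e).comp_snd ν

/-- Gaussian integration by parts in one coordinate of a standard Gaussian vector. -/
lemma integral_eval_mul_pi_gaussianReal [DecidableEq E] (e : E) {g g' : (E → ℝ) → ℝ}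
    (hg : ∀ x y, HasDerivAt (fun y => g (Function.update x e y)) (g' (Function.update x e y)) y)
    (hgm : Measurable g) (hg'm : Measurable g') {C C' : ℝ}
    (hC : ∀ x, |g x| ≤ C) (hC' : ∀ x, |g' x| ≤ C') :
    ∫ x, x e * g x ∂(Measure.pi fun _ : E => gaussianReal 0 1)
      = ∫ x, g' x ∂(Measure.pi fun _ : E => gaussianReal 0 1) := by
  have hmp := measurePreserving_update_pi (fun _ : E => gaussianReal 0 1) e
  have hi := integrable_eval_mul_pi_gaussianReal e hgm hC
  have hi' : Integrable g' (Measure.pi fun _ : E => gaussianReal 0 1) :=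
    .of_bound hg'm.aestronglyMeasurable C' (.of_forall hC')
  rw [← hmp.map_eq] at hi hi' ⊢
  rw [integral_map hmp.aemeasurable hi.aestronglyMeasurable,
    integral_map hmp.aemeasurable hi'.aestronglyMeasurable,
    integral_prod _ (by exact hi.comp_aemeasurable hmp.aemeasurable),
    integral_prod _ (by exact hi'.comp_aemeasurable hmp.aemeasurable)]
  refine integral_congr_ae (.of_forall fun x => ?_)
  simp only [Function.update_self]
  exact integral_id_mul_gaussianReal (hg x) (hg'm.comp (measurable_update x)) (fun _ => hC _)
    (fun _ => hC' _)

end GaussianIntegrationByParts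

section Interpolation

variable {S : Type*} [Fintype S] [Nonempty S] {n : ℕ}
  {A : Type*} [TopologicalSpace A] {E : Type*} [Fintype E]

/-- Log-weights given by a random background `B` and a Gaussian field of strength `x` with
direction vectors `v e`. -/
def fieldLogWeight (B : A → S → ℝ) (v : E → S → ℝ) (x : ℝ) (J : A × (E → ℝ)) (s : S) : ℝ :=
  B J.1 s + x * ∑ e, J.2 e * v e s

lemma continuous_gibbsAvg_fieldLogWeight {B : A → S → ℝ} (hB : ∀ s, Continuous fun a => B a s)
    (v : E → S → ℝ) (x : ℝ) (f : (Fin n → S) → ℝ) :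
    Continuous fun J => gibbsAvg n (fieldLogWeight B v x J) f := by
  refine Continuous.gibbsAvg (fun s => ?_) f
  have := hB s
  unfold fieldLogWeight
  fun_prop

variable [MeasurableSpace A] [BorelSpace A]

lemma integrable_gibbsAvg_fieldLogWeight (ν : Measure A) [IsProbabilityMeasure ν]
    {B : A → S → ℝ} (hB : ∀ s, Continuous fun a => B a s)
    (v : E → S → ℝ) (x : ℝ) (f : (Fin n → S) → ℝ) :
    Integrable (fun J => gibbsAvg n (fieldLogWeight B v x J) f)
      (ν.prod (Measure.pi fun _ : E => gaussianReal 0 1)) :=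
  .of_bound (continuous_gibbsAvg_fieldLogWeight hB v x f).measurable.aestronglyMeasurable
    (∑ R, |f R|) (.of_forall fun _ => abs_gibbsAvg_le _ _)

lemma integral_eval_mul_gibbsAvg (ν : Measure A) [IsProbabilityMeasure ν]
    {B : A → S → ℝ} (hB : ∀ s, Continuous fun a => B a s)
    (v : E → S → ℝ) (x : ℝ) (f : (Fin n → S) → ℝ) (e : E) :
    ∫ J, J.2 e * gibbsAvg n (fieldLogWeight B v x J) f
        ∂(ν.prod (Measure.pi fun _ : E => gaussianReal 0 1))
      = x * ∫ J, gibbsAvg (n + 1) (fieldLogWeight B v x J) (replicaDeriv (v e) f)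
        ∂(ν.prod (Measure.pi fun _ : E => gaussianReal 0 1)) := by
  classical
  have hc := continuous_gibbsAvg_fieldLogWeight hB v x f
  have hc' := continuous_gibbsAvg_fieldLogWeight hB v x (replicaDeriv (v e) f)
  rw [← integral_const_mul, integral_prod, integral_prod]
  · refine integral_congr_ae (.of_forall fun a => ?_)
    refine integral_eval_mul_pi_gaussianReal e
      (g := fun y => gibbsAvg n (fieldLogWeight B v x (a, y)) f)
      (g' := fun y => x * gibbsAvg (n + 1) (fieldLogWeight B v x (a, y)) (replicaDeriv (v e) f))
      (fun y z => ?_) ?_ ?_ (fun _ => abs_gibbsAvg_le _ _)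
      (C' := |x| * ∑ R, |replicaDeriv (v e) f R|) fun _ => ?_
    · rw [← gibbsAvg_const_mul, ← replicaDeriv_const_mul]
      refine HasDerivAt.gibbsAvg
        (H := fun z => fieldLogWeight B v x (a, Function.update y e z)) (fun s => ?_) f
      unfold fieldLogWeight
      have h : HasDerivAt (fun z => ∑ i, Function.update y e z i * v i s) (v e s) z := by
        have := HasDerivAt.fun_sum (u := Finset.univ) fun i _ =>
          (hasDerivAt_pi.1 (hasDerivAt_update y e z) i).mul_const (v i s)
        refine this.congr_deriv ?_
        simp [Pi.single_apply]
      exact (h.const_mul x).const_add (B a s)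
    · exact (hc.comp (by fun_prop : Continuous fun y : E → ℝ => (a, y))).measurable
    · exact ((hc'.comp (by fun_prop : Continuous fun y : E → ℝ => (a, y))).measurable).const_mul x
    · rw [abs_mul]
      gcongr
      exact abs_gibbsAvg_le _ _
  · exact (integrable_gibbsAvg_fieldLogWeight ν hB v x _).const_mul x
  · exact (integrable_snd_eval ν e).mul_bdd hc.measurable.aestronglyMeasurable
      (.of_forall fun _ => abs_gibbsAvg_le _ _)

/-- Derivative of a quenched Gibbs average in the strength of the Gaussian field. -/
lemma hasDerivAt_integral_gibbsAvg (ν : Measure A) [IsProbabilityMeasure ν]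
    {B : A → S → ℝ} (hB : ∀ s, Continuous fun a => B a s)
    (v : E → S → ℝ) (x : ℝ) (f : (Fin n → S) → ℝ) :
    HasDerivAt
      (fun y => ∫ J, gibbsAvg n (fieldLogWeight B v y J) f
        ∂(ν.prod (Measure.pi fun _ : E => gaussianReal 0 1)))
      (x * ∫ J, gibbsAvg (n + 2) (fieldLogWeight B v x J)
          (fun R => ∑ e, replicaDeriv (v e) (replicaDeriv (v e) f) R)
        ∂(ν.prod (Measure.pi fun _ : E => gaussianReal 0 1))) x := by
  have hsum : ∀ (y : ℝ) (J : A × (E → ℝ)),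
      gibbsAvg (n + 1) (fieldLogWeight B v y J)
        (replicaDeriv (fun s => ∑ e, J.2 e * v e s) f)
      = ∑ e, J.2 e * gibbsAvg (n + 1) (fieldLogWeight B v y J) (replicaDeriv (v e) f) := by
    intro y J
    rw [replicaDeriv_sum, gibbsAvg_sum]
  have hmeas : ∀ (m : ℕ) (y : ℝ) (g : (Fin m → S) → ℝ),
      AEStronglyMeasurable (fun J => gibbsAvg m (fieldLogWeight B v y J) g)
        (ν.prod (Measure.pi fun _ : E => gaussianReal 0 1)) := fun m y g =>
    (continuous_gibbsAvg_fieldLogWeight hB v y g).measurable.aestronglyMeasurable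
  have hint : ∀ e, Integrable (fun J : A × (E → ℝ) => J.2 e *
      gibbsAvg (n + 1) (fieldLogWeight B v x J) (replicaDeriv (v e) f))
      (ν.prod (Measure.pi fun _ : E => gaussianReal 0 1)) := fun e =>
    (integrable_snd_eval ν e).mul_bdd (hmeas _ _ _) (.of_forall fun _ => abs_gibbsAvg_le _ _)
  have hderiv := (hasDerivAt_integral_of_dominated_loc_of_deriv_le (x₀ := x)
    (μ := ν.prod (Measure.pi fun _ : E => gaussianReal 0 1))
    (F := fun y J => gibbsAvg n (fieldLogWeight B v y J) f)
    (F' := fun y J => ∑ e, J.2 e *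
      gibbsAvg (n + 1) (fieldLogWeight B v y J) (replicaDeriv (v e) f))
    (bound := fun J => ∑ e, |J.2 e| * ∑ R, |replicaDeriv (v e) f R|)
    Filter.univ_mem (.of_forall fun y => hmeas _ _ _)
    (integrable_gibbsAvg_fieldLogWeight ν hB v x f)
    (integrable_finsetSum _ fun e _ => hint e).aestronglyMeasurable
    (.of_forall fun J y _ => ?_)
    (integrable_finsetSum _ fun e _ => (integrable_snd_eval ν e).abs.mul_const _)
    (.of_forall fun J y _ => ?_)).2
  · refine hderiv.congr_deriv ?_
    rw [integral_finsetSum _ fun e _ => hint e]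
    have h1 : ∀ J : A × (E → ℝ), gibbsAvg (n + 2) (fieldLogWeight B v x J)
        (fun R => ∑ e, replicaDeriv (v e) (replicaDeriv (v e) f) R)
        = ∑ e, gibbsAvg (n + 2) (fieldLogWeight B v x J)
          (replicaDeriv (v e) (replicaDeriv (v e) f)) := fun J => by
      simpa using gibbsAvg_sum Finset.univ (fieldLogWeight B v x J) (fun _ : E => (1 : ℝ))
        (fun e => replicaDeriv (v e) (replicaDeriv (v e) f))
    simp_rw [h1]
    rw [integral_finsetSum _ fun e _ => integrable_gibbsAvg_fieldLogWeight ν hB v x _,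
      Finset.mul_sum]
    exact Finset.sum_congr rfl fun e _ => integral_eval_mul_gibbsAvg ν hB v x _ e
  · refine (Finset.abs_sum_le_sum_abs _ _).trans (Finset.sum_le_sum fun e _ => ?_)
    rw [abs_mul]
    gcongr
    exact abs_gibbsAvg_le _ _
  · rw [← hsum]
    refine HasDerivAt.gibbsAvg (H := fun y => fieldLogWeight B v y J) (fun s => ?_) f
    unfold fieldLogWeight
    simpa using ((hasDerivAt_id y).mul_const (∑ e, J.2 e * v e s)).const_add (B J.1 s)

end Interpolation

section OverlapAverages

variable {N M : ℕ}

lemma spinval_mul_self (b : Bool) : spinval b * spinval b = 1 := by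
  cases b <;> simp [spinval]

lemma ovlp_comm (σ σ' : Fin N → Bool) : ovlp N σ σ' = ovlp N σ' σ := by
  simp [ovlp, mul_comm]

lemma ovlp_self (hN : 1 ≤ N) (σ : Fin N → Bool) : ovlp N σ σ = 1 := by
  have : (N : ℝ) ≠ 0 := by positivity
  simp [ovlp, spinval_mul_self, this]

variable {n : ℕ} (R : Fin n → (Fin N → Bool) × (Fin M → Bool))

lemma qq_comm (a b : Fin n) : qq N M n R a b = qq N M n R b a := by
  simp only [qq, ovlp_comm]

lemma qq_self (hN : 1 ≤ N) (hM : 1 ≤ M) (a : Fin n) : qq N M n R a a = 1 := by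
  simp [qq, ovlp_self hN, ovlp_self hM]

/-- The pattern `σ_i τ_k` coupled to `J̃_{ik}`. -/
def spinProd (e : Fin N × Fin M) (s : (Fin N → Bool) × (Fin M → Bool)) : ℝ :=
  spinval (s.2 e.2) * spinval (s.1 e.1)

lemma sum_spinProd_mul (hN : 1 ≤ N) (hM : 1 ≤ M) (a b : Fin n) :
    ∑ e : Fin N × Fin M, spinProd e (R a) * spinProd e (R b) = N * M * qq N M n R a b := by
  have hN' : (N : ℝ) ≠ 0 := by positivity
  have hM' : (M : ℝ) ≠ 0 := by positivity
  have h : (N : ℝ) * M * qq N M n R a b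
      = (∑ i, spinval ((R a).1 i) * spinval ((R b).1 i))
        * ∑ k, spinval ((R a).2 k) * spinval ((R b).2 k) := by
    simp only [qq, ovlp]
    field_simp
  rw [h, Finset.sum_mul_sum, Fintype.sum_prod_type]
  refine Finset.sum_congr rfl fun i _ => Finset.sum_congr rfl fun k _ => ?_
  simp only [spinProd]
  ring

/-- Log-weight `log ξ_τ` of the cavity measure. -/
def backgroundLogWeight (N M : ℕ) (β : ℝ) (J : Fin M × Fin M → ℝ)
    (s : (Fin N → Bool) × (Fin M → Bool)) : ℝ :=
  (β / Real.sqrt M) * ∑ k : Fin M, ∑ l : Fin M, J (k, l) * spinval (s.2 k) * spinval (s.2 l)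

lemma replicaAvg_eq_integral_gibbsAvg (n N M : ℕ) (β t : ℝ)
    (f : (Fin n → (Fin N → Bool) × (Fin M → Bool)) → ℝ) :
    replicaAvg n N M β t f = ∫ J, gibbsAvg n (fieldLogWeight (backgroundLogWeight N M β) spinProd
      (Real.sqrt (t / ((N : ℝ) * M))) J) f ∂couplingLaw N M := by
  have h : ∀ J s, cavityWeight N M β t J s = Real.exp (fieldLogWeight
      (backgroundLogWeight N M β) spinProd (Real.sqrt (t / ((N : ℝ) * M))) J s) := by
    intro J s
    simp only [cavityWeight, fieldLogWeight, backgroundLogWeight, spinProd,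
      Fintype.sum_prod_type, mul_assoc]
  simp only [replicaAvg, cavityZ, gibbsAvg, h]

lemma sum_replicaDeriv_replicaDeriv (hN : 1 ≤ N) (hM : 1 ≤ M)
    (f : (Fin 3 → (Fin N → Bool) × (Fin M → Bool)) → ℝ)
    (R : Fin 5 → (Fin N → Bool) × (Fin M → Bool)) :
    ∑ e, replicaDeriv (spinProd e) (replicaDeriv (spinProd e) f) R
      = 2 * (N * M) * (f (Fin.tail (Fin.tail R)) *
        ((qq N M 5 R 2 3 + qq N M 5 R 2 4 + qq N M 5 R 3 4)
          - (qq N M 5 R 1 2 + qq N M 5 R 1 3 + qq N M 5 R 1 4)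
          - 2 * (qq N M 5 R 0 2 + qq N M 5 R 0 3 + qq N M 5 R 0 4) + 6 * qq N M 5 R 0 1)) := by
  set c : Fin 5 → Fin 5 → ℝ := fun a b => ∑ e, spinProd e (R a) * spinProd e (R b) with hc
  have hcq : ∀ a b, c a b = N * M * qq N M 5 R a b := sum_spinProd_mul R hN hM
  have hexp : ∑ e, replicaDeriv (spinProd e) (replicaDeriv (spinProd e) f) R
      = f (Fin.tail (Fin.tail R)) * ((c 2 2 + c 3 3 + c 4 4 + 2 * (c 2 3 + c 2 4 + c 3 4))
        - 2 * (c 1 2 + c 1 3 + c 1 4) - 3 * c 1 1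
        - 4 * (c 0 2 + c 0 3 + c 0 4) + 12 * c 0 1) := by
    simp only [hc, Finset.mul_sum, ← Finset.sum_add_distrib, ← Finset.sum_sub_distrib]
    refine Finset.sum_congr rfl fun e _ => ?_
    simp only [replicaDeriv, Fin.sum_univ_succ, Fin.tail, Finset.univ_eq_empty, Finset.sum_empty,
      Fin.succ_zero_eq_one, Fin.isValue]
    simp only [show (Fin.succ 1 : Fin 4) = 2 from rfl, show (Fin.succ 1 : Fin 5) = 2 from rfl,
      show (Fin.succ 2 : Fin 5) = 3 from rfl, show (Fin.succ 2 : Fin 4) = 3 from rfl,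
      show (Fin.succ 3 : Fin 5) = 4 from rfl, show (Fin.succ 1 : Fin 3) = 2 from rfl]
    push_cast
    ring
  rw [hexp]
  simp only [hcq, qq_self R hN hM]
  ring

lemma gibbsAvg_qq_comp (H : (Fin N → Bool) × (Fin M → Bool) → ℝ) {σ : Fin n → Fin n}
    (hσ : Function.Injective σ) (a b c d i j : Fin n) :
    gibbsAvg n H (fun R => qq N M n R (σ a) (σ b) * qq N M n R (σ c) (σ d)
        * qq N M n R (σ i) (σ j))
      = gibbsAvg n H (fun R => qq N M n R a b * qq N M n R c d * qq N M n R i j) :=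
  gibbsAvg_perm H (Equiv.ofBijective σ (Finite.injective_iff_bijective.1 hσ))
    (fun R => qq N M n R a b * qq N M n R c d * qq N M n R i j)

lemma gibbsAvg_streaming (H : (Fin N → Bool) × (Fin M → Bool) → ℝ) :
    gibbsAvg 5 H (fun R => qq N M 5 R 2 3 * qq N M 5 R 3 4 *
        ((qq N M 5 R 2 3 + qq N M 5 R 2 4 + qq N M 5 R 3 4)
          - (qq N M 5 R 1 2 + qq N M 5 R 1 3 + qq N M 5 R 1 4)
          - 2 * (qq N M 5 R 0 2 + qq N M 5 R 0 3 + qq N M 5 R 0 4) + 6 * qq N M 5 R 0 1))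
      = gibbsAvg 5 H (fun R =>
        qq N M 5 R 0 1 * qq N M 5 R 1 2 * qq N M 5 R 0 2
        + 2 * ((qq N M 5 R 0 1) ^ 2 * qq N M 5 R 1 2)
        - 6 * (qq N M 5 R 0 1 * qq N M 5 R 1 2 * qq N M 5 R 2 3)
        - 3 * (qq N M 5 R 0 1 * qq N M 5 R 0 2 * qq N M 5 R 0 3)
        + 6 * (qq N M 5 R 0 1 * qq N M 5 R 2 3 * qq N M 5 R 3 4)) := by
  set T : Fin 5 → Fin 5 → Fin 5 → Fin 5 → Fin 5 → Fin 5 → ℝ := fun a b c d i j =>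
    gibbsAvg 5 H (fun R => qq N M 5 R a b * qq N M 5 R c d * qq N M 5 R i j) with hT
  have hperm : ∀ (σ : Fin 5 → Fin 5), Function.Injective σ → ∀ a b c d i j,
      T (σ a) (σ b) (σ c) (σ d) (σ i) (σ j) = T a b c d i j :=
    fun σ hσ => gibbsAvg_qq_comp H hσ
  have hcomm1 : ∀ a b c d i j, T a b c d i j = T b a c d i j := fun a b c d i j => by
    simp only [hT, qq_comm _ a b]
  have hcomm2 : ∀ a b c d i j, T a b c d i j = T a b d c i j := fun a b c d i j => by
    simp only [hT, qq_comm _ c d]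
  have hcomm3 : ∀ a b c d i j, T a b c d i j = T a b c d j i := fun a b c d i j => by
    simp only [hT, qq_comm _ i j]
  have hswap12 : ∀ a b c d i j, T a b c d i j = T c d a b i j := fun a b c d i j => by
    simp only [hT, mul_comm (qq N M 5 _ a b)]
  have hswap23 : ∀ a b c d i j, T a b c d i j = T a b i j c d := fun a b c d i j => by
    simp only [hT, mul_right_comm _ (qq N M 5 _ c d)]
  have hL : gibbsAvg 5 H (fun R => qq N M 5 R 2 3 * qq N M 5 R 3 4 *
        ((qq N M 5 R 2 3 + qq N M 5 R 2 4 + qq N M 5 R 3 4)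
          - (qq N M 5 R 1 2 + qq N M 5 R 1 3 + qq N M 5 R 1 4)
          - 2 * (qq N M 5 R 0 2 + qq N M 5 R 0 3 + qq N M 5 R 0 4) + 6 * qq N M 5 R 0 1))
      = T 2 3 3 4 2 3 + T 2 3 3 4 2 4 + T 2 3 3 4 3 4
        - T 2 3 3 4 1 2 - T 2 3 3 4 1 3 - T 2 3 3 4 1 4
        - 2 * T 2 3 3 4 0 2 - 2 * T 2 3 3 4 0 3 - 2 * T 2 3 3 4 0 4 + 6 * T 2 3 3 4 0 1 := by
    simp only [hT, sub_eq_add_neg, ← neg_mul, ← gibbsAvg_const_mul, ← gibbsAvg_add,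
      neg_eq_neg_one_mul (gibbsAvg _ _ _)]
    congr 1
    funext R
    ring
  have hR : gibbsAvg 5 H (fun R =>
        qq N M 5 R 0 1 * qq N M 5 R 1 2 * qq N M 5 R 0 2
        + 2 * ((qq N M 5 R 0 1) ^ 2 * qq N M 5 R 1 2)
        - 6 * (qq N M 5 R 0 1 * qq N M 5 R 1 2 * qq N M 5 R 2 3)
        - 3 * (qq N M 5 R 0 1 * qq N M 5 R 0 2 * qq N M 5 R 0 3)
        + 6 * (qq N M 5 R 0 1 * qq N M 5 R 2 3 * qq N M 5 R 3 4))
      = T 0 1 1 2 0 2 + 2 * T 0 1 1 2 0 1 - 6 * T 0 1 1 2 2 3 - 3 * T 0 1 0 2 0 3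
        + 6 * T 0 1 2 3 3 4 := by
    simp only [hT, sub_eq_add_neg, ← neg_mul, ← gibbsAvg_const_mul, ← gibbsAvg_add,
      neg_eq_neg_one_mul (gibbsAvg _ _ _)]
    congr 1
    funext R
    ring
  have h1 : T 2 3 3 4 2 3 = T 0 1 1 2 0 1 := hperm ![2, 3, 4, 0, 1] (by decide) 0 1 1 2 0 1
  have h2 : T 2 3 3 4 2 4 = T 0 1 1 2 0 2 := hperm ![2, 3, 4, 0, 1] (by decide) 0 1 1 2 0 2
  have h3 : T 2 3 3 4 3 4 = T 0 1 1 2 0 1 := by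
    rw [hswap12, hcomm1, hcomm2, hcomm3]
    exact hperm ![4, 3, 2, 0, 1] (by decide) 0 1 1 2 0 1
  have chainLeft : ∀ x : Fin 5, x = 0 ∨ x = 1 → T 2 3 3 4 x 2 = T 0 1 1 2 2 3 := by
    intro x hx
    rw [hswap12, hcomm1, hcomm2, hcomm3]
    rcases hx with rfl | rfl
    · exact hperm ![4, 3, 2, 0, 1] (by decide) 0 1 1 2 2 3
    · exact hperm ![4, 3, 2, 1, 0] (by decide) 0 1 1 2 2 3
  have chainRight : ∀ x : Fin 5, x = 0 ∨ x = 1 → T 2 3 3 4 x 4 = T 0 1 1 2 2 3 := by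
    intro x hx
    rw [hcomm3]
    rcases hx with rfl | rfl
    · exact hperm ![2, 3, 4, 0, 1] (by decide) 0 1 1 2 2 3
    · exact hperm ![2, 3, 4, 1, 0] (by decide) 0 1 1 2 2 3
  have star : ∀ x : Fin 5, x = 0 ∨ x = 1 → T 2 3 3 4 x 3 = T 0 1 0 2 0 3 := by
    intro x hx
    rw [hcomm1, hcomm3]
    rcases hx with rfl | rfl
    · exact hperm ![3, 2, 4, 0, 1] (by decide) 0 1 0 2 0 3
    · exact hperm ![3, 2, 4, 1, 0] (by decide) 0 1 0 2 0 3
  have h4 : T 2 3 3 4 0 1 = T 0 1 2 3 3 4 := by rw [hswap23, hswap12]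
  rw [hL, hR, h1, h2, h3, chainLeft 0 (.inl rfl), chainLeft 1 (.inr rfl),
    chainRight 0 (.inl rfl), chainRight 1 (.inr rfl), star 0 (.inl rfl), star 1 (.inr rfl), h4]
  ring

end OverlapAverages

/-- `d/dt ⟨q₁₂q̃₁₂q₂₃q̃₂₃⟩_t = ⟨q₁₂q̃₁₂q₂₃q̃₂₃q₁₃q̃₁₃ + 2 q₁₂²q̃₁₂²q₂₃q̃₂₃
− 6 q₁₂q̃₁₂q₂₃q̃₂₃q₃₄q̃₃₄ − 3 q₁₂q̃₁₂q₁₃q̃₁₃q₁₄q̃₁₄ + 6 q₁₂q̃₁₂q₃₄q̃₃₄q₄₅q̃₄₅⟩_t`. -/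
theorem streaming_q12q23 (N M : ℕ) (hN : 1 ≤ N) (hM : 1 ≤ M)
    (β : ℝ) (hβ : 0 ≤ β) (t : ℝ) (ht : 0 < t) :
    HasDerivAt
      (fun t' => replicaAvg 3 N M β t' (fun R => qq N M 3 R 0 1 * qq N M 3 R 1 2))
      (replicaAvg 5 N M β t (fun R =>
        qq N M 5 R 0 1 * qq N M 5 R 1 2 * qq N M 5 R 0 2
        + 2 * ((qq N M 5 R 0 1) ^ 2 * qq N M 5 R 1 2)
        - 6 * (qq N M 5 R 0 1 * qq N M 5 R 1 2 * qq N M 5 R 2 3)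
        - 3 * (qq N M 5 R 0 1 * qq N M 5 R 0 2 * qq N M 5 R 0 3)
        + 6 * (qq N M 5 R 0 1 * qq N M 5 R 2 3 * qq N M 5 R 3 4)))
      t := by
  have hNM : (0 : ℝ) < N * M := by positivity
  have hx : 0 < Real.sqrt (t / ((N : ℝ) * M)) := Real.sqrt_pos.2 (by positivity)
  have hB : ∀ s, Continuous fun a => backgroundLogWeight N M β a s := fun s => by
    unfold backgroundLogWeight
    fun_prop
  have hsqrt : HasDerivAt (fun t' : ℝ => Real.sqrt (t' / ((N : ℝ) * M)))
      (1 / ((N : ℝ) * M) / (2 * Real.sqrt (t / ((N : ℝ) * M)))) t :=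
    ((hasDerivAt_id t).div_const _).sqrt (by simp only [id]; positivity)
  have hmain := (hasDerivAt_integral_gibbsAvg
    (Measure.pi fun _ : Fin M × Fin M => gaussianReal 0 1) hB spinProd
    (Real.sqrt (t / ((N : ℝ) * M)))
    (fun R => qq N M 3 R 0 1 * qq N M 3 R 1 2)).comp t hsqrt
  simp only [replicaAvg_eq_integral_gibbsAvg]
  refine hmain.congr_deriv ?_
  simp only [sum_replicaDeriv_replicaDeriv hN hM, gibbsAvg_const_mul]
  rw [integral_const_mul, couplingLaw, integral_congr_ae (.of_forall fun J =>
    (gibbsAvg_streaming (fieldLogWeight (backgroundLogWeight N M β) spinProd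
      (Real.sqrt (t / ((N : ℝ) * M))) J)).symm)]
  change _ = ∫ J, gibbsAvg 5 _ _ ∂_
  field_simp
  rfl
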